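/- For every real ν and every x > 0, the Bateman functions k_ν and k_{ν+2} are differentiable at x and satisfy k_ν'(x) + k_{ν+2}'(x) = k_ν(x) − k_{ν+2}(x). -/

import Mathlib

/-- The Bateman function `k_ν(x) = (2/π) ∫₀^{π/2} cos(x·tan θ − ν·θ) dθ`. -/
noncomputable def batemanK (ν x : ℝ) : ℝ :=
  (2 / Real.pi) * ∫ θ in (0:ℝ)..(Real.pi / 2), Real.cos (x * Real.tan θ - ν * θ)

open MeasureTheory in
/-- Measurable functions that are bounded are interval integrable. -/
theorem intervalIntegrable_of_measurable_of_abs_le {f : ℝ → ℝ} (hf : Measurable f) {C : ℝ}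
    (hC : ∀ t, |f t| ≤ C) (a b : ℝ) : IntervalIntegrable f volume a b :=
  (intervalIntegrable_const (c := C)).mono_fun' hf.aestronglyMeasurable
    (Filter.Eventually.of_forall hC)

theorem measurable_real_tan : Measurable Real.tan := by
  have h : Real.tan = fun x => Real.sin x / Real.cos x := funext Real.tan_eq_sin_div_cos
  rw [h]
  fun_prop

theorem abs_cos_mul_tan_le_one (θ : ℝ) : |Real.cos θ * Real.tan θ| ≤ 1 := by
  by_cases h : Real.cos θ = 0
  · simp [h]
  · rw [mul_comm, Real.tan_mul_cos h]
    exact Real.abs_sin_le_one θ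

open MeasureTheory in
/-- Differentiation under the integral sign for oscillatory integrals with phase `y * tan θ - c θ`
and an amplitude `a` such that `a θ * tan θ` is bounded. -/
theorem hasDerivAt_integral_mul_cos_tan {a c : ℝ → ℝ} (ha : Continuous a) (hc : Continuous c)
    {C : ℝ} (hC : ∀ θ, |a θ * Real.tan θ| ≤ C) (u v x : ℝ) :
    HasDerivAt (fun y => ∫ θ in u..v, a θ * Real.cos (y * Real.tan θ - c θ))
      (∫ θ in u..v, -(a θ * Real.tan θ) * Real.sin (x * Real.tan θ - c θ)) x := by
  have htan := measurable_real_tan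
  have ham := ha.measurable
  have hcm := hc.measurable
  have hmeas : ∀ y, Measurable fun θ => a θ * Real.cos (y * Real.tan θ - c θ) := by
    intro y
    fun_prop
  refine (intervalIntegral.hasDerivAt_integral_of_dominated_loc_of_deriv_le
    (F := fun y θ => a θ * Real.cos (y * Real.tan θ - c θ))
    (F' := fun y θ => -(a θ * Real.tan θ) * Real.sin (y * Real.tan θ - c θ))
    (bound := fun _ => C) (s := Set.univ) Filter.univ_mem
    (Filter.Eventually.of_forall fun y => (hmeas y).aestronglyMeasurable) ?_ ?_ ?_
    intervalIntegrable_const ?_).2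
  · refine (ha.abs.intervalIntegrable u v).mono_fun' (hmeas x).aestronglyMeasurable
      (Filter.Eventually.of_forall fun θ => ?_)
    simp only [Real.norm_eq_abs, abs_mul]
    exact mul_le_of_le_one_right (abs_nonneg _) (Real.abs_cos_le_one _)
  · exact Measurable.aestronglyMeasurable (by fun_prop)
  · refine Filter.Eventually.of_forall fun θ _ y _ => ?_
    rw [Real.norm_eq_abs, abs_mul, abs_neg]
    exact (mul_le_of_le_one_right (abs_nonneg _) (Real.abs_sin_le_one _)).trans (hC θ)
  · refine Filter.Eventually.of_forall fun θ _ y _ => ?_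
    have h := ((((hasDerivAt_id y).mul_const (Real.tan θ)).sub_const (c θ)).cos).const_mul (a θ)
    refine h.congr_deriv ?_
    simp only [id]
    ring

theorem intervalIntegrable_cos_tan (ν x : ℝ) :
    IntervalIntegrable (fun θ => Real.cos (x * Real.tan θ - ν * θ)) MeasureTheory.volume 0
      (Real.pi / 2) := by
  have htan := measurable_real_tan
  exact intervalIntegrable_of_measurable_of_abs_le (by fun_prop)
    (fun θ => Real.abs_cos_le_one _) _ _

/-- The function `θ ↦ cos² θ · sin (x tan θ - ν θ)` is continuous at the zeros of `cos` too. -/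
theorem continuous_cos_sq_mul_sin_tan (ν x : ℝ) :
    Continuous fun θ => Real.cos θ ^ 2 * Real.sin (x * Real.tan θ - ν * θ) := by
  rw [continuous_iff_continuousAt]
  intro θ
  by_cases h : Real.cos θ = 0
  · have h0 : Filter.Tendsto (fun θ => Real.cos θ ^ 2) (nhds θ) (nhds 0) := by
      have : Continuous fun θ => Real.cos θ ^ 2 := by fun_prop
      simpa [h] using this.tendsto θ
    have hlim : Filter.Tendsto (fun θ => Real.cos θ ^ 2 * Real.sin (x * Real.tan θ - ν * θ))
        (nhds θ) (nhds 0) := by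
      refine squeeze_zero_norm (fun t => ?_) h0
      rw [Real.norm_eq_abs, abs_mul, abs_of_nonneg (sq_nonneg (Real.cos t))]
      exact mul_le_of_le_one_right (sq_nonneg _) (Real.abs_sin_le_one _)
    simpa [ContinuousAt, h] using hlim
  · have := Real.continuousAt_tan.2 h
    fun_prop

/-- Integration by parts: `x k_ν(x)` as an integral that may be differentiated in `x`. -/
theorem mul_integral_cos_tan (ν x : ℝ) :
    x * ∫ θ in (0:ℝ)..(Real.pi / 2), Real.cos (x * Real.tan θ - ν * θ) =
      (∫ θ in (0:ℝ)..(Real.pi / 2), (2 * Real.sin θ * Real.cos θ) *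
        Real.cos (x * Real.tan θ - (ν * θ + Real.pi / 2))) +
      ∫ θ in (0:ℝ)..(Real.pi / 2), (ν * Real.cos θ ^ 2) * Real.cos (x * Real.tan θ - ν * θ) := by
  have htan := measurable_real_tan
  have hint (a c : ℝ → ℝ) (ha : Continuous a) (hc : Continuous c) :
      IntervalIntegrable (fun θ => a θ * Real.cos (x * Real.tan θ - c θ)) MeasureTheory.volume 0
        (Real.pi / 2) := by
    have hcm := hc.measurable
    exact (intervalIntegrable_of_measurable_of_abs_le (by fun_prop)
      (fun θ => Real.abs_cos_le_one _) _ _).continuousOn_mul ha.continuousOn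
  have h0 := (intervalIntegrable_cos_tan ν x).const_mul x
  have h1 := hint (fun θ => 2 * Real.sin θ * Real.cos θ) (fun θ => ν * θ + Real.pi / 2)
    (by fun_prop) (by fun_prop)
  have h2 := hint (fun θ => ν * Real.cos θ ^ 2) (fun θ => ν * θ) (by fun_prop) (by fun_prop)
  have key := intervalIntegral.integral_eq_sub_of_hasDerivAt_of_le (by positivity)
    (continuous_cos_sq_mul_sin_tan ν x).continuousOn (fun θ hθ => ?_) (h0.sub (h1.add h2))
  · rw [intervalIntegral.integral_sub h0 (h1.add h2), intervalIntegral.integral_add h1 h2,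
      intervalIntegral.integral_const_mul] at key
    simp only [Real.cos_pi_div_two, Real.tan_zero, mul_zero, sub_zero, Real.sin_zero] at key
    linarith
  · have hcos : Real.cos θ ≠ 0 :=
      (Real.cos_pos_of_mem_Ioo ⟨by linarith [hθ.1, Real.pi_pos], hθ.2⟩).ne'
    have h := ((Real.hasDerivAt_cos θ).pow 2).mul
      ((((Real.hasDerivAt_tan hcos).const_mul x).sub ((hasDerivAt_id θ).const_mul ν)).sin)
    refine h.congr_deriv ?_
    simp only [id, Pi.sub_apply, Pi.pow_apply, ← sub_sub, Real.cos_sub_pi_div_two]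
    field_simp
    push_cast
    ring

theorem differentiableAt_batemanK (ν : ℝ) {x : ℝ} (hx : x ≠ 0) :
    DifferentiableAt ℝ (batemanK ν) x := by
  have h1 := hasDerivAt_integral_mul_cos_tan (a := fun θ => 2 * Real.sin θ * Real.cos θ)
    (c := fun θ => ν * θ + Real.pi / 2) (by fun_prop) (by fun_prop) (C := 2) (fun θ => by
      rw [mul_assoc, abs_mul, abs_mul, abs_two]
      nlinarith [abs_cos_mul_tan_le_one θ, Real.abs_sin_le_one θ, abs_nonneg (Real.sin θ),
        abs_nonneg (Real.cos θ * Real.tan θ)]) 0 (Real.pi / 2) x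
  have h2 := hasDerivAt_integral_mul_cos_tan (a := fun θ => ν * Real.cos θ ^ 2)
    (c := fun θ => ν * θ) (by fun_prop) (by fun_prop) (C := |ν|) (fun θ => by
      rw [sq, mul_assoc, mul_assoc, abs_mul, abs_mul]
      exact mul_le_of_le_one_right (abs_nonneg _) (mul_le_one₀ (Real.abs_cos_le_one θ)
        (abs_nonneg _) (abs_cos_mul_tan_le_one θ))) 0 (Real.pi / 2) x
  have h := ((h1.add h2).differentiableAt.div differentiableAt_id hx).const_mul (2 / Real.pi)
  refine h.congr_of_eventuallyEq ?_
  filter_upwards [isOpen_ne.mem_nhds hx] with y hy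
  have hy' : y ≠ 0 := hy
  simp only [batemanK, Pi.add_apply, Pi.div_apply, id]
  rw [← mul_integral_cos_tan, mul_div_cancel_left₀ _ hy']

theorem batemanK_add (ν x : ℝ) :
    batemanK ν x + batemanK (ν + 2) x = (2 / Real.pi) * ∫ θ in (0:ℝ)..(Real.pi / 2),
      (2 * Real.cos θ) * Real.cos (x * Real.tan θ - (ν + 1) * θ) := by
  rw [batemanK, batemanK, ← mul_add, ← intervalIntegral.integral_add
    (intervalIntegrable_cos_tan ν x) (intervalIntegrable_cos_tan (ν + 2) x)]
  congr 2 with θ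
  rw [show x * Real.tan θ - ν * θ = (x * Real.tan θ - (ν + 1) * θ) + θ by ring,
    show x * Real.tan θ - (ν + 2) * θ = (x * Real.tan θ - (ν + 1) * θ) - θ by ring,
    Real.cos_add, Real.cos_sub (x * Real.tan θ - (ν + 1) * θ)]
  ring

theorem batemanK_sub (ν x : ℝ) :
    batemanK ν x - batemanK (ν + 2) x = (2 / Real.pi) * ∫ θ in (0:ℝ)..(Real.pi / 2),
      -((2 * Real.cos θ) * Real.tan θ) * Real.sin (x * Real.tan θ - (ν + 1) * θ) := by
  rw [batemanK, batemanK, ← mul_sub, ← intervalIntegral.integral_sub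
    (intervalIntegrable_cos_tan ν x) (intervalIntegrable_cos_tan (ν + 2) x)]
  congr 1
  refine intervalIntegral.integral_congr_Ioo_of_le (by positivity) fun θ hθ => ?_
  have hcos : Real.cos θ ≠ 0 :=
    (Real.cos_pos_of_mem_Ioo ⟨by linarith [hθ.1, Real.pi_pos], hθ.2⟩).ne'
  rw [show 2 * Real.cos θ * Real.tan θ = 2 * Real.sin θ by
      rw [mul_assoc, mul_comm (Real.cos θ), Real.tan_mul_cos hcos],
    show x * Real.tan θ - ν * θ = (x * Real.tan θ - (ν + 1) * θ) + θ by ring,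
    show x * Real.tan θ - (ν + 2) * θ = (x * Real.tan θ - (ν + 1) * θ) - θ by ring,
    Real.cos_add, Real.cos_sub (x * Real.tan θ - (ν + 1) * θ)]
  ring

theorem bateman_deriv_sum (ν x : ℝ) (hx : 0 < x) :
    DifferentiableAt ℝ (batemanK ν) x ∧ DifferentiableAt ℝ (batemanK (ν + 2)) x ∧
    deriv (batemanK ν) x + deriv (batemanK (ν + 2)) x = batemanK ν x - batemanK (ν + 2) x := by
  have h1 := differentiableAt_batemanK ν hx.ne'
  have h2 := differentiableAt_batemanK (ν + 2) hx.ne'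
  refine ⟨h1, h2, ?_⟩
  have h := (hasDerivAt_integral_mul_cos_tan (a := fun θ => 2 * Real.cos θ)
    (c := fun θ => (ν + 1) * θ) (by fun_prop) (by fun_prop) (C := 2) (fun θ => by
      rw [mul_assoc, abs_mul, abs_two]
      linarith [abs_cos_mul_tan_le_one θ]) 0 (Real.pi / 2) x).const_mul (2 / Real.pi)
  rw [batemanK_sub, ← h.deriv, ← deriv_add h1 h2]
  congr 1
  exact funext (batemanK_add ν)
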